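/- Let n ∈ ℕ with n ≥ 3 and let H = {(k,i) ∈ ℕ₀² : k = i = 0 or k > i}, a submonoid of (ℕ₀², +). Then the map Φ : 𝓛(B_n) → H defined by Φ(x + (n−2)·[0,q]) = (x,q) is a monoid isomorphism (where 𝓛(B_n) carries set addition); moreover H is a reduced atomic commutative cancellative half-factorial monoid with set of atoms A(H) = {(k, k−1) : k ∈ ℕ}. -/

import Mathlib

/-- An atom (irreducible element) of a monoid: a non-unit `u` such that
`u = b * c` implies that `b` or `c` is a unit. -/
def IsMonAtom {M : Type*} [Monoid M] (u : M) : Prop :=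
  ¬ IsUnit u ∧ ∀ b c : M, u = b * c → IsUnit b ∨ IsUnit c

/-- A monoid is reduced if its only invertible element is `1`. -/
def MonReduced (M : Type*) [Monoid M] : Prop := ∀ u : M, IsUnit u → u = 1

/-- A monoid is (left and right) unit-cancellative if `a = a * u` or `a = u * a`
implies that `u` is a unit. -/
def UnitCancellative (M : Type*) [Monoid M] : Prop :=
  (∀ a u : M, a * u = a → IsUnit u) ∧ (∀ a u : M, u * a = a → IsUnit u)

/-- A monoid is atomic if every non-unit is a finite product of atoms. -/
def MonAtomic (M : Type*) [Monoid M] : Prop :=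
  ∀ a : M, ¬ IsUnit a → ∃ l : List M, (∀ u ∈ l, IsMonAtom u) ∧ l.prod = a

attribute [local instance] Classical.propDecidable

/-- The set of lengths `L(a)` of an element: the set of all `k ∈ ℕ` such that `a`
is a product of `k` atoms, with the convention `L(1) = {0}`. -/
noncomputable def setOfLengths {M : Type*} [Monoid M] (x : M) : Set ℕ :=
  if x = 1 then {0}
  else {k | ∃ l : List M, l.length = k ∧ (∀ u ∈ l, IsMonAtom u) ∧ l.prod = x}

/-- The system of sets of lengths `𝓛(M) = {L(a) : a ∈ M}`. -/
def LSystem (M : Type*) [Monoid M] : Set (Set ℕ) :=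
  Set.range (setOfLengths (M := M))

/-- `U_k(M)`, the union of all sets of lengths containing `k`. -/
def unionOfLengths (M : Type*) [Monoid M] (k : ℕ) : Set ℕ :=
  ⋃₀ {L | L ∈ LSystem M ∧ k ∈ L}
/-- The defining relation `b * a = b ^ n` of the monoid `B_n`, on the free
monoid over two generators (`0` stands for `a`, `1` stands for `b`). -/
def BnRel (n : ℕ) : FreeMonoid (Fin 2) → FreeMonoid (Fin 2) → Prop := fun x y =>
  x = FreeMonoid.of 1 * FreeMonoid.of 0 ∧ y = FreeMonoid.of 1 ^ n

/-- The congruence on the free monoid generated by the relation `b * a = b ^ n`. -/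
def BnCon (n : ℕ) : Con (FreeMonoid (Fin 2)) := conGen (BnRel n)

/-- The monoid `B_n = ⟨ a, b ∣ b * a = b ^ n ⟩`. -/
abbrev Bn (n : ℕ) := (BnCon n).Quotient

/-- The generator `a` of `B_n`. -/
def bA (n : ℕ) : Bn n := (BnCon n).mk' (FreeMonoid.of 0)

/-- The generator `b` of `B_n`. -/
def bB (n : ℕ) : Bn n := (BnCon n).mk' (FreeMonoid.of 1)
/-- The quantity `q_{m,n}`. -/
def qOf (m n : ℕ) : ℕ :=
  if m = 0 then 0 else if (n - 1) ∣ m then m / (n - 1) - 1 else m / (n - 1)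

/-- The arithmetical progression `x + d·[0,q] = {x + d*j : 0 ≤ j ≤ q}`. -/
def apSet (x d q : ℕ) : Set ℕ := {y | ∃ j : ℕ, j ≤ q ∧ y = x + d * j}

open scoped Pointwise

/-- An atom of an additive monoid. -/
def IsAddMonAtom {M : Type*} [AddMonoid M] (u : M) : Prop :=
  ¬ IsAddUnit u ∧ ∀ b c : M, u = b + c → IsAddUnit b ∨ IsAddUnit c

/-- The set of lengths of an element of an additive monoid. -/
noncomputable def addSetOfLengths {M : Type*} [AddMonoid M] (x : M) : Set ℕ :=
  if x = 0 then {0}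
  else {k | ∃ l : List M, l.length = k ∧ (∀ u ∈ l, IsAddMonAtom u) ∧ l.sum = x}

/-- The additive submonoid `H = {(k,i) ∈ ℕ₀² : k = i = 0 or k > i}` of `ℕ₀ × ℕ₀`. -/
def pairMonoid : AddSubmonoid (ℕ × ℕ) where
  carrier := {p | (p.1 = 0 ∧ p.2 = 0) ∨ p.2 < p.1}
  zero_mem' := Or.inl ⟨rfl, rfl⟩
  add_mem' := by
    rintro ⟨a, b⟩ ⟨c, d⟩ h₁ h₂
    simp only [Set.mem_setOf_eq, Prod.mk_add_mk] at *
    omega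

section PresentedMonoid

variable (d : ℕ)

/-- The left action of the two generators of `B_n` (with `n = d + 2`) on the normal forms
`a ^ i * b ^ m`, encoded as pairs `(i, m)`. -/
def bnLetter : Fin 2 → Function.End (ℕ × ℕ)
  | 0 => fun p => (p.1 + 1, p.2)
  | 1 => fun p => (0, 1 + (d + 1) * p.1 + p.2)

theorem bnLetter_one_pow (m : ℕ) (p : ℕ × ℕ) :
    (bnLetter d 1 ^ (m + 1)) p = (0, m + 1 + (d + 1) * p.1 + p.2) := by
  induction m with
  | zero =>
    rw [zero_add, pow_one]
    rfl
  | succ m ih =>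
    rw [pow_succ']
    change bnLetter d 1 ((bnLetter d 1 ^ (m + 1)) p) = _
    rw [ih]
    simp only [bnLetter, Prod.mk.injEq, true_and]
    ring

/-- The action of `B_n` on normal forms. -/
def bnAct : Bn (d + 2) →* Function.End (ℕ × ℕ) :=
  (BnCon (d + 2)).lift (FreeMonoid.lift (bnLetter d)) <| Con.conGen_le.2 <| by
    rintro _ _ ⟨rfl, rfl⟩
    simp only [Con.ker_rel, map_mul, map_pow, FreeMonoid.lift_eval_of]
    funext p
    rw [bnLetter_one_pow]
    change bnLetter d 1 (bnLetter d 0 p) = _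
    simp only [bnLetter, Prod.mk.injEq, true_and]
    ring

/-- The weight on `B_n` for which `a` has weight `n - 1` and `b` has weight `1`. -/
def bnWeight : Bn (d + 2) →* Multiplicative ℕ :=
  (BnCon (d + 2)).lift
    (FreeMonoid.lift ![Multiplicative.ofAdd (d + 1), Multiplicative.ofAdd 1]) <|
      Con.conGen_le.2 <| by
    rintro _ _ ⟨rfl, rfl⟩
    simp only [Con.ker_rel, map_mul, map_pow, FreeMonoid.lift_eval_of]
    apply Multiplicative.toAdd.injective
    simp
    ring

/-- The normal form of an element of `B_n`: the pair `(i, m)` stands for `a ^ i * b ^ m`. -/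
def bnNormal (x : Bn (d + 2)) : ℕ × ℕ := bnAct d x (0, 0)

variable {d}

theorem bnNormal_one : bnNormal d 1 = (0, 0) := by
  rw [bnNormal, map_one]
  rfl

theorem bnNormal_bA_mul (x : Bn (d + 2)) :
    bnNormal d (bA (d + 2) * x) = ((bnNormal d x).1 + 1, (bnNormal d x).2) := by
  simp only [bnNormal, map_mul]
  rfl

theorem bnNormal_bB_mul (x : Bn (d + 2)) :
    bnNormal d (bB (d + 2) * x) = (0, 1 + (d + 1) * (bnNormal d x).1 + (bnNormal d x).2) := by
  simp only [bnNormal, map_mul]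
  rfl

theorem toAdd_bnWeight_bA : (bnWeight d (bA (d + 2))).toAdd = d + 1 := rfl

theorem toAdd_bnWeight_bB : (bnWeight d (bB (d + 2))).toAdd = 1 := rfl

theorem Bn.induction {n : ℕ} {p : Bn n → Prop} (one : p 1)
    (bA_mul : ∀ x, p x → p (bA n * x)) (bB_mul : ∀ x, p x → p (bB n * x)) (x : Bn n) : p x := by
  induction x using Con.induction_on with
  | H w =>
    induction w using FreeMonoid.inductionOn' with
    | one => exact one
    | of_mul c w ih =>
      fin_cases c
      · exact bA_mul _ ih
      · exact bB_mul _ ih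

theorem bB_mul_bA (n : ℕ) : bB n * bA n = bB n ^ n :=
  (BnCon n).eq.2 (ConGen.Rel.of _ _ ⟨rfl, rfl⟩)

theorem bB_mul_bA_pow (i : ℕ) :
    bB (d + 2) * bA (d + 2) ^ i = bB (d + 2) ^ (1 + (d + 1) * i) := by
  induction i with
  | zero => simp
  | succ i ih =>
    rw [pow_succ, ← mul_assoc, ih, add_comm 1, pow_succ, mul_assoc, bB_mul_bA, ← pow_add]
    congr 1
    ring

theorem bA_pow_mul_bB_pow_bnNormal (x : Bn (d + 2)) :
    bA (d + 2) ^ (bnNormal d x).1 * bB (d + 2) ^ (bnNormal d x).2 = x := by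
  induction x using Bn.induction with
  | one => simp [bnNormal_one]
  | bA_mul x ih => rw [bnNormal_bA_mul, pow_succ', mul_assoc, ih]
  | bB_mul x ih =>
    rw [bnNormal_bB_mul, pow_add, ← bB_mul_bA_pow, pow_zero, one_mul, mul_assoc, ih]

theorem bnNormal_injective : Function.Injective (bnNormal d) := fun x y h => by
  rw [← bA_pow_mul_bB_pow_bnNormal x, h, bA_pow_mul_bB_pow_bnNormal]

theorem bnNormal_bA_pow_mul_bB_pow (i m : ℕ) :
    bnNormal d (bA (d + 2) ^ i * bB (d + 2) ^ m) = (i, m) := by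
  induction i with
  | zero =>
    induction m with
    | zero => simp [bnNormal_one]
    | succ m ih =>
      simp only [pow_zero, one_mul] at ih ⊢
      rw [pow_succ', bnNormal_bB_mul, ih]
      simp [add_comm]
  | succ i ih => rw [pow_succ', mul_assoc, bnNormal_bA_mul, ih]

theorem bnWeight_eq_one_iff {x : Bn (d + 2)} : bnWeight d x = 1 ↔ x = 1 := by
  refine ⟨fun h => ?_, fun h => by rw [h, map_one]⟩
  replace h := congrArg Multiplicative.toAdd h
  induction x using Bn.induction with
  | one => rfl
  | bA_mul x ih =>
    rw [map_mul, toAdd_mul, toAdd_bnWeight_bA, toAdd_one] at h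
    omega
  | bB_mul x ih =>
    rw [map_mul, toAdd_mul, toAdd_bnWeight_bB, toAdd_one] at h
    omega

theorem Bn.isUnit_iff {x : Bn (d + 2)} : IsUnit x ↔ x = 1 := by
  refine ⟨fun h => bnWeight_eq_one_iff.1 ?_, fun h => h ▸ isUnit_one⟩
  obtain ⟨y, hy⟩ := (h.map (bnWeight d)).exists_right_inv
  have := congrArg Multiplicative.toAdd hy
  rw [toAdd_mul, toAdd_one] at this
  apply Multiplicative.toAdd.injective
  rw [toAdd_one]
  omega

theorem bA_ne_one : bA (d + 2) ≠ 1 := fun h => by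
  have := bnNormal_bA_mul (1 : Bn (d + 2))
  simp [h, bnNormal_one] at this

theorem bB_ne_one : bB (d + 2) ≠ 1 := fun h => by
  have := bnNormal_bB_mul (1 : Bn (d + 2))
  simp [h, bnNormal_one] at this

theorem Bn.eq_one_or_exists_mul (x : Bn (d + 2)) :
    x = 1 ∨ (∃ y, x = bA (d + 2) * y) ∨ ∃ y, x = bB (d + 2) * y := by
  induction x using Bn.induction with
  | one => exact Or.inl rfl
  | bA_mul x _ => exact Or.inr (Or.inl ⟨x, rfl⟩)
  | bB_mul x _ => exact Or.inr (Or.inr ⟨x, rfl⟩)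

theorem isMonAtom_bA : IsMonAtom (bA (d + 2)) := by
  refine ⟨fun h => bA_ne_one (Bn.isUnit_iff.1 h), fun x y h => ?_⟩
  have hN := bnNormal_bA_mul (1 : Bn (d + 2))
  rw [mul_one, h, bnNormal_one] at hN
  obtain rfl | ⟨z, rfl⟩ | ⟨z, rfl⟩ := x.eq_one_or_exists_mul
  · exact Or.inl isUnit_one
  · right
    rw [mul_assoc, bnNormal_bA_mul] at hN
    have hzy : z * y = 1 := bnNormal_injective (by
      rw [bnNormal_one]
      ext <;> simp_all)
    rw [Bn.isUnit_iff, ← bnWeight_eq_one_iff]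
    have := congrArg (fun t => (bnWeight d t).toAdd) hzy
    simp only [map_mul, toAdd_mul, map_one, toAdd_one] at this
    apply Multiplicative.toAdd.injective
    rw [toAdd_one]
    omega
  · rw [mul_assoc, bnNormal_bB_mul] at hN
    simp at hN

theorem isMonAtom_bB : IsMonAtom (bB (d + 2)) := by
  refine ⟨fun h => bB_ne_one (Bn.isUnit_iff.1 h), fun x y h => ?_⟩
  have hw := congrArg (fun t => (bnWeight d t).toAdd) h
  simp only [map_mul, toAdd_mul, toAdd_bnWeight_bB] at hw
  rw [Bn.isUnit_iff, Bn.isUnit_iff, ← bnWeight_eq_one_iff, ← bnWeight_eq_one_iff,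
    ← Multiplicative.toAdd.injective.eq_iff,
    ← Multiplicative.toAdd.injective.eq_iff (a := bnWeight d y), toAdd_one]
  omega

theorem Bn.isMonAtom_iff {x : Bn (d + 2)} :
    IsMonAtom x ↔ x = bA (d + 2) ∨ x = bB (d + 2) := by
  refine ⟨fun h => ?_, ?_⟩
  · obtain rfl | ⟨y, rfl⟩ | ⟨y, rfl⟩ := x.eq_one_or_exists_mul
    · exact absurd isUnit_one h.1
    · rcases h.2 _ _ rfl with hu | hu
      · exact absurd (Bn.isUnit_iff.1 hu) bA_ne_one
      · simp [Bn.isUnit_iff.1 hu]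
    · rcases h.2 _ _ rfl with hu | hu
      · exact absurd (Bn.isUnit_iff.1 hu) bB_ne_one
      · simp [Bn.isUnit_iff.1 hu]
  · rintro (rfl | rfl)
    exacts [isMonAtom_bA, isMonAtom_bB]

theorem Bn.exists_length_add_mul_eq (l : List (Bn (d + 2))) (hl : ∀ u ∈ l, IsMonAtom u) :
    ∃ q, l.length + d * q = (bnNormal d l.prod).1 + (bnNormal d l.prod).2 ∧
      (q = 0 ∨ (d + 1) * q + 1 ≤ (bnNormal d l.prod).2) := by
  induction l with
  | nil => exact ⟨0, by simp [bnNormal_one]⟩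
  | cons u l ih =>
    obtain ⟨q, hq, hq'⟩ := ih fun v hv => hl v (List.mem_cons_of_mem _ hv)
    rw [List.prod_cons, List.length_cons]
    rcases Bn.isMonAtom_iff.1 (hl u List.mem_cons_self) with rfl | rfl
    · rw [bnNormal_bA_mul]
      exact ⟨q, by dsimp only; omega, hq'⟩
    · rw [bnNormal_bB_mul]
      refine ⟨q + (bnNormal d l.prod).1, by dsimp only; linarith, Or.inr ?_⟩
      rcases hq' with rfl | hq'
      · dsimp only; linarith
      · dsimp only; linarith

theorem mem_setOfLengths_bA_pow_mul_bB_pow {i m k : ℕ} :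
    k ∈ setOfLengths (bA (d + 2) ^ i * bB (d + 2) ^ m) ↔
      ∃ q, k + d * q = i + m ∧ (q = 0 ∨ (d + 1) * q + 1 ≤ m) := by
  have hN := bnNormal_bA_pow_mul_bB_pow (d := d) i m
  unfold setOfLengths
  split_ifs with h
  · rw [h, bnNormal_one, Prod.mk.injEq] at hN
    obtain ⟨rfl, rfl⟩ := hN
    constructor
    · rintro rfl
      exact ⟨0, by simp⟩
    · rintro ⟨q, hq, -⟩
      rw [Set.mem_singleton_iff]
      omega
  · constructor
    · rintro ⟨l, rfl, hl, hprod⟩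
      have := Bn.exists_length_add_mul_eq l hl
      rwa [hprod, hN] at this
    · rintro ⟨q, hk, rfl | hq⟩
      · refine ⟨List.replicate i (bA (d + 2)) ++ List.replicate m (bB (d + 2)), ?_, ?_, ?_⟩
        · simpa using hk.symm
        · intro u hu
          rw [List.mem_append, List.mem_replicate, List.mem_replicate] at hu
          exact Bn.isMonAtom_iff.2 (hu.imp And.right And.right)
        · simp
      · obtain ⟨r, rfl⟩ := Nat.exists_eq_add_of_le hq
        refine ⟨List.replicate i (bA (d + 2)) ++ (bB (d + 2) ::
          (List.replicate q (bA (d + 2)) ++ List.replicate r (bB (d + 2)))), ?_, ?_, ?_⟩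
        · simp only [List.length_append, List.length_cons, List.length_replicate]
          linarith
        · intro u hu
          simp only [List.mem_append, List.mem_cons, List.mem_replicate] at hu
          rw [Bn.isMonAtom_iff]
          tauto
        · simp only [List.prod_append, List.prod_cons, List.prod_replicate]
          rw [← mul_assoc (bB (d + 2)), bB_mul_bA_pow, ← pow_add, add_comm 1]

theorem setOfLengths_bA_pow_mul_bB_pow (i m : ℕ) :
    setOfLengths (bA (d + 2) ^ i * bB (d + 2) ^ m) =
      apSet (i + m - d * ((m - 1) / (d + 1))) d ((m - 1) / (d + 1)) := by
  have hQ : ∀ q, (q = 0 ∨ (d + 1) * q + 1 ≤ m) ↔ q ≤ (m - 1) / (d + 1) := fun q => by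
    rw [Nat.le_div_iff_mul_le (by omega), mul_comm q]
    rcases Nat.eq_zero_or_pos q with rfl | hq
    · simp
    · have : 0 < (d + 1) * q := by positivity
      omega
  have hle : d * ((m - 1) / (d + 1)) ≤ i + m := by
    have := Nat.mul_div_le (m - 1) (d + 1)
    rw [Nat.succ_mul] at this
    generalize (m - 1) / (d + 1) = Q at *
    omega
  ext k
  simp_rw [mem_setOfLengths_bA_pow_mul_bB_pow, hQ]
  generalize (m - 1) / (d + 1) = Q at *
  constructor
  · rintro ⟨q, hk, hq⟩
    obtain ⟨r, rfl⟩ := Nat.exists_eq_add_of_le hq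
    refine ⟨r, Nat.le_add_left _ _, ?_⟩
    rw [mul_add] at hle ⊢
    omega
  · rintro ⟨r, hr, rfl⟩
    obtain ⟨q, rfl⟩ := Nat.exists_eq_add_of_le hr
    refine ⟨q, ?_, Nat.le_add_left _ _⟩
    rw [mul_add] at hle ⊢
    omega

theorem LSystem_Bn :
    LSystem (Bn (d + 2)) = (fun p : ℕ × ℕ => apSet p.1 d p.2) '' pairMonoid := by
  ext L
  constructor
  · rintro ⟨x, rfl⟩
    rw [← bA_pow_mul_bB_pow_bnNormal x, setOfLengths_bA_pow_mul_bB_pow]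
    generalize (bnNormal d x).1 = i
    generalize (bnNormal d x).2 = m
    refine ⟨(_, _), ?_, rfl⟩
    change (_ = 0 ∧ _ = 0) ∨ _ < _
    have := Nat.mul_div_le (m - 1) (d + 1)
    rw [Nat.succ_mul] at this
    generalize (m - 1) / (d + 1) = Q at *
    omega
  · rintro ⟨⟨x, q⟩, ⟨h₁, h₂⟩ | h, rfl⟩
    · refine ⟨bA (d + 2) ^ 0 * bB (d + 2) ^ 0, ?_⟩
      dsimp only at h₁ h₂
      subst h₁ h₂
      rw [setOfLengths_bA_pow_mul_bB_pow]
      simp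
    · refine ⟨bA (d + 2) ^ (x - q - 1) * bB (d + 2) ^ ((d + 1) * q + 1), ?_⟩
      rw [setOfLengths_bA_pow_mul_bB_pow, Nat.add_sub_cancel, Nat.mul_div_cancel_left _ d.succ_pos]
      congr 1
      dsimp only at h
      rw [Nat.succ_mul]
      omega

end PresentedMonoid

theorem apSet_add_apSet (x y d p q : ℕ) :
    apSet x d p + apSet y d q = apSet (x + y) d (p + q) := by
  ext k
  rw [Set.mem_add]
  constructor
  · rintro ⟨_, ⟨i, hi, rfl⟩, _, ⟨j, hj, rfl⟩, rfl⟩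
    exact ⟨i + j, add_le_add hi hj, by ring⟩
  · rintro ⟨j, hj, rfl⟩
    refine ⟨_, ⟨min j p, min_le_right _ _, rfl⟩, _, ⟨j - min j p, by omega, rfl⟩, ?_⟩
    have : j = min j p + (j - min j p) := by omega
    conv_rhs => rw [this]
    ring

theorem apSet_subset {x y d p q : ℕ} (h : apSet x d p ⊆ apSet y d q) :
    y ≤ x ∧ x + d * p ≤ y + d * q := by
  obtain ⟨i, -, hi⟩ := h ⟨0, p.zero_le, rfl⟩
  obtain ⟨j, hj, hj'⟩ := h ⟨p, le_rfl, rfl⟩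
  have := Nat.mul_le_mul_left d hj
  omega

theorem apSet_injective {d : ℕ} (hd : 0 < d) :
    Function.Injective fun p : ℕ × ℕ => apSet p.1 d p.2 := by
  rintro ⟨x, p⟩ ⟨y, q⟩ h
  obtain ⟨h₁, h₂⟩ := apSet_subset h.subset
  obtain ⟨h₃, h₄⟩ := apSet_subset h.symm.subset
  dsimp only at *
  obtain rfl := le_antisymm h₁ h₃
  rw [Prod.mk.injEq]
  exact ⟨rfl, Nat.eq_of_mul_eq_mul_left hd (by omega)⟩

namespace pairMonoid

theorem mem_iff {k i : ℕ} : (k, i) ∈ pairMonoid ↔ (k = 0 ∧ i = 0) ∨ i < k := Iff.rfl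

theorem isAddUnit_iff {p : pairMonoid} : IsAddUnit p ↔ p = 0 := by
  refine ⟨fun h => ?_, fun h => h ▸ isAddUnit_zero⟩
  obtain ⟨q, hq⟩ := h.exists_neg
  have h₁ := congrArg (fun r : pairMonoid => r.1.1) hq
  have h₂ := congrArg (fun r : pairMonoid => r.1.2) hq
  simp at h₁ h₂
  exact Subtype.ext (Prod.ext h₁.1 h₂.1)

theorem isAddMonAtom_iff {u : pairMonoid} : IsAddMonAtom u ↔ u.1.1 = u.1.2 + 1 := by
  obtain ⟨⟨k, i⟩, hu⟩ := u
  simp only [IsAddMonAtom, isAddUnit_iff]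
  constructor
  · rintro ⟨h₀, h⟩
    have h₀ : ¬ (k = 0 ∧ i = 0) := by simpa [Subtype.ext_iff] using h₀
    have hik := (mem_iff.1 hu).resolve_left h₀
    have := h ⟨(k - i - 1, 0), mem_iff.2 (by omega)⟩ ⟨(i + 1, i), mem_iff.2 (by omega)⟩
      (Subtype.ext (Prod.ext (by simp; omega) (by simp)))
    simp [Subtype.ext_iff] at this
    omega
  · intro h
    refine ⟨by simp [Subtype.ext_iff]; omega, ?_⟩
    rintro ⟨⟨a, b⟩, hb⟩ ⟨⟨a', b'⟩, hc⟩ hbc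
    simp only [Subtype.ext_iff, AddSubmonoid.coe_add, Prod.mk_add_mk, Prod.mk.injEq] at hbc
    simp only [Subtype.ext_iff, ZeroMemClass.coe_zero, Prod.mk_eq_zero]
    rw [mem_iff] at hb hc
    omega

theorem sum_fst_eq_sum_snd_add_length (l : List pairMonoid) (hl : ∀ u ∈ l, IsAddMonAtom u) :
    l.sum.1.1 = l.sum.1.2 + l.length := by
  induction l with
  | nil => rfl
  | cons u l ih =>
    have h₁ := isAddMonAtom_iff.1 (hl u List.mem_cons_self)
    have h₂ := ih fun v hv => hl v (List.mem_cons_of_mem _ hv)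
    simp only [List.sum_cons, AddSubmonoid.coe_add, Prod.fst_add, Prod.snd_add, List.length_cons]
    omega

theorem exists_list_sum_eq (p : pairMonoid) :
    ∃ l : List pairMonoid, (∀ u ∈ l, IsAddMonAtom u) ∧ l.sum = p := by
  obtain ⟨⟨k, i⟩, h⟩ := p
  by_cases h₀ : k = 0 ∧ i = 0
  · exact ⟨[], by simp, Subtype.ext (Prod.ext h₀.1.symm h₀.2.symm)⟩
  · have hik := (mem_iff.1 h).resolve_left h₀
    refine ⟨⟨(i + 1, i), mem_iff.2 (by omega)⟩ ::
      List.replicate (k - i - 1) ⟨(1, 0), mem_iff.2 (by omega)⟩, ?_, ?_⟩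
    · intro u hu
      rw [isAddMonAtom_iff]
      rcases List.mem_cons.1 hu with rfl | hu
      · rfl
      · rw [List.eq_of_mem_replicate hu]
    · refine Subtype.ext (Prod.ext ?_ ?_)
      · simp
        omega
      · simp

theorem addSetOfLengths_eq (p : pairMonoid) : addSetOfLengths p = {p.1.1 - p.1.2} := by
  unfold addSetOfLengths
  split_ifs with h
  · simp [h]
  · obtain ⟨l, hl, hsum⟩ := exists_list_sum_eq p
    ext k
    rw [Set.mem_singleton_iff]
    constructor
    · rintro ⟨l, rfl, hl, rfl⟩
      rw [sum_fst_eq_sum_snd_add_length l hl, Nat.add_sub_cancel_left]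
    · rintro rfl
      refine ⟨l, ?_, hl, hsum⟩
      rw [← hsum, sum_fst_eq_sum_snd_add_length l hl, Nat.add_sub_cancel_left]

end pairMonoid

/-- For `n ≥ 3`, the map `Φ : 𝓛(B_n) → H`,
`x + (n−2)·[0,q] ↦ (x,q)`, is an isomorphism from `(𝓛(B_n), +)` (set addition)
onto `H = {(k,i) ∈ ℕ₀² : k = i = 0 or k > i}`; moreover `H` is a reduced atomic
commutative cancellative half-factorial monoid with atoms `{(k, k−1) : k ≥ 1}`. -/
theorem statement10 (n : ℕ) (hn : 3 ≤ n) :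
    (∃ Φ : Set ℕ → ℕ × ℕ,
      (∀ x q : ℕ, ((x = 0 ∧ q = 0) ∨ q < x) → Φ (apSet x (n - 2) q) = (x, q)) ∧
      Set.BijOn Φ (LSystem (Bn n)) (pairMonoid : Set (ℕ × ℕ)) ∧
      (∀ L₁ ∈ LSystem (Bn n), ∀ L₂ ∈ LSystem (Bn n),
        Φ (L₁ + L₂) = Φ L₁ + Φ L₂)) ∧
    -- `H` is reduced
    (∀ p : pairMonoid, IsAddUnit p → p = 0) ∧
    -- `H` is commutative and cancellative
    (∀ p q : pairMonoid, p + q = q + p) ∧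
    (∀ p q r : pairMonoid, p + q = p + r → q = r) ∧
    -- `H` is atomic
    (∀ p : pairMonoid, p ≠ 0 →
      ∃ l : List pairMonoid, (∀ u ∈ l, IsAddMonAtom u) ∧ l.sum = p) ∧
    -- `H` is half-factorial
    (∀ p : pairMonoid, ∃ k : ℕ, addSetOfLengths p = {k}) ∧
    -- the atoms of `H`
    {u : pairMonoid | IsAddMonAtom u} = {u : pairMonoid | ∃ k : ℕ, 0 < k ∧ (u : ℕ × ℕ) = (k, k - 1)} := by
  refine ⟨?_, fun p => pairMonoid.isAddUnit_iff.1, add_comm, fun _ _ _ => add_left_cancel,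
    fun p _ => pairMonoid.exists_list_sum_eq p,
    fun p => ⟨_, pairMonoid.addSetOfLengths_eq p⟩, ?_⟩
  · obtain ⟨d, rfl⟩ := Nat.exists_eq_add_of_le' (Nat.le_of_succ_le hn)
    have hinj := apSet_injective (d := d) (by omega)
    have hleft := Function.leftInverse_invFun hinj
    rw [LSystem_Bn, Nat.add_sub_cancel]
    refine ⟨Function.invFun fun p : ℕ × ℕ => apSet p.1 d p.2, fun x q _ => hleft (x, q), ?_, ?_⟩
    · refine ⟨?_, ?_, fun p hp => ⟨_, ⟨p, hp, rfl⟩, hleft p⟩⟩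
      · rintro _ ⟨p, hp, rfl⟩
        rwa [hleft]
      · rintro _ ⟨p, -, rfl⟩ _ ⟨q, -, rfl⟩ h
        rw [hleft, hleft] at h
        rw [h]
    · rintro _ ⟨p, -, rfl⟩ _ ⟨q, -, rfl⟩
      rw [hleft, hleft]
      simp only [apSet_add_apSet]
      exact hleft (p + q)
  · ext u
    rw [Set.mem_ofPred_eq, Set.mem_ofPred_eq, pairMonoid.isAddMonAtom_iff]
    constructor
    · exact fun h => ⟨u.1.1, by omega, Prod.ext rfl (by dsimp only; omega)⟩
    · rintro ⟨k, hk, h⟩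
      rw [h]
      dsimp only
      omega
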